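/- The homomorphism φ : R → S is injective. -/

import Mathlib

open CategoryTheory Opposite MvPowerSeries

set_option synthInstance.maxHeartbeats 1000000
set_option maxHeartbeats 1000000

noncomputable section

/-- The grade of an ideal: the maximal length of a regular sequence contained in it. -/
def idealGrade {A : Type} [CommRing A] (J : Ideal A) : ℕ∞ :=
  sSup {c : ℕ∞ | ∃ rs : List A, (∀ r ∈ rs, r ∈ J) ∧
    RingTheory.Sequence.IsRegular A rs ∧ (rs.length : ℕ∞) = c}

/-- The height of an ideal: the infimum of heights of primes containing it. -/
def idealHeight {A : Type} [CommRing A] (J : Ideal A) : ℕ∞ :=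
  sInf {h : ℕ∞ | ∃ p : PrimeSpectrum A, J ≤ p.asIdeal ∧ Order.height p = h}

/-- A canonical module of a `d`-dimensional local ring `A`: a finitely generated module `ω`
with `Ext_A^i(𝕜, ω) = 0` for `i ≠ d` and `Ext_A^d(𝕜, ω)` a one-dimensional `𝕜`-vector space
(equivalently, isomorphic to `𝕜` as an `A`-module), where `𝕜` is the residue field. -/
def IsCanonicalModule (A : Type) [CommRing A] [IsLocalRing A] (d : ℕ)
    (ω : ModuleCat A) : Prop :=
  Module.Finite A ω ∧
  (∀ i : ℕ, i ≠ d → Subsingleton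
    (((Ext A (ModuleCat A) i).obj
      (op (ModuleCat.of A (IsLocalRing.ResidueField A)))).obj ω)) ∧
  Nonempty ((((Ext A (ModuleCat A) d).obj
      (op (ModuleCat.of A (IsLocalRing.ResidueField A)))).obj ω)
    ≃ₗ[A] IsLocalRing.ResidueField A)

variable (𝕜 : Type) [Field 𝕜] (m n : ℕ)

/-- The formal power series ring `P` in the entries of an `m × n` matrix of variables. -/
abbrev DetP := MvPowerSeries (Fin m × Fin n) 𝕜

/-- The ideal of `P` generated by the `2 × 2` minors of the matrix of variables. -/
def detI2 : Ideal (DetP 𝕜 m n) :=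
  Ideal.span {f | ∃ (i k : Fin m) (j l : Fin n), i < k ∧ j < l ∧
    f = X (i, j) * X (k, l) - X (i, l) * X (k, j)}

/-- The complete determinantal ring `R = P/I₂(X)`. -/
abbrev DetR := DetP 𝕜 m n ⧸ detI2 𝕜 m n

/-- The residue class in `R` of the variable `x_{ij}`. -/
def detx (i : Fin m) (j : Fin n) : DetR 𝕜 m n :=
  Ideal.Quotient.mk (detI2 𝕜 m n) (X (i, j))

/-- The ideal `I` of `R` generated by the entries of the first `n - 1` columns. -/
def detJ : Ideal (DetR 𝕜 m n) :=
  Ideal.span {x | ∃ (i : Fin m) (j : Fin n), (j : ℕ) < n - 1 ∧ x = detx 𝕜 m n i j}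

/-- The formal power series ring `S = 𝕜[[x_1, …, x_m, a_1, …, a_{n-1}]]`. -/
abbrev DetS := MvPowerSeries (Fin m ⊕ Fin (n - 1)) 𝕜

/-- The ideal `𝔞 = (a_1, …, a_{n-1})S`. -/
def detA : Ideal (DetS 𝕜 m n) :=
  Ideal.span {f | ∃ j : Fin (n - 1), f = X (Sum.inr j)}

/-- The property pinning down the local `𝕜`-algebra homomorphism `φ : R → S`:
`x_{ij} ↦ a_j·x_i` for `1 ≤ j ≤ n-1` and `x_{in} ↦ x_i` (in `0`-based indexing, the last
column is `j = n-1`).  Any `𝕜`-algebra homomorphism `R → S` with these values on the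
variables automatically maps the maximal ideal into the maximal ideal, hence is continuous
and is uniquely determined by these values; so this predicate characterizes `φ`. -/
def IsDetPhi (φ : DetR 𝕜 m n →ₐ[𝕜] DetS 𝕜 m n) : Prop :=
  ∀ (i : Fin m) (j : Fin n),
    φ (detx 𝕜 m n i j) =
      if h : (j : ℕ) < n - 1 then X (Sum.inr (⟨j, h⟩ : Fin (n - 1))) * X (Sum.inl i)
      else X (Sum.inl i)

namespace MvPowerSeries

/-- A power series of order at least `N` in finitely many variables is a combination of the
monomials of degree `N`. -/
lemma exists_eq_sum_monomial_mul {σ k : Type*} [Finite σ] [CommRing k] (N : ℕ)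
    (f : MvPowerSeries σ k) (hf : ∀ e, e.degree < N → coeff e f = 0) :
    ∃ g : (σ →₀ ℕ) → MvPowerSeries σ k,
      f = ∑ u ∈ (Finsupp.finite_of_degree_eq (σ := σ) N).toFinset, monomial u 1 * g u := by
  classical
  have hex (e : σ →₀ ℕ) : ∃ u : σ →₀ ℕ, N ≤ e.degree → u ≤ e ∧ u.degree = N := by
    by_cases h : N ≤ e.degree
    · obtain ⟨u, hu⟩ := Finsupp.exists_le_degree_eq e N h
      exact ⟨u, fun _ => hu⟩
    · exact ⟨0, fun h' => absurd h' h⟩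
  choose u hu using hex
  obtain ⟨g, hg⟩ : ∃ g : (σ →₀ ℕ) → MvPowerSeries σ k,
      ∀ v d, coeff d (g v) = if u (v + d) = v then coeff (v + d) f else 0 :=
    ⟨fun v d => if u (v + d) = v then coeff (v + d) f else 0, fun _ _ => rfl⟩
  refine ⟨g, ?_⟩
  ext e
  rw [map_sum]
  simp only [coeff_monomial_mul, one_mul]
  by_cases he : N ≤ e.degree
  · rw [Finset.sum_eq_single (u e)]
    · rw [if_pos (hu e he).1, hg, add_tsub_cancel_of_le (hu e he).1, if_pos rfl]
    · intro v _ hv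
      split_ifs with hve
      · rw [hg, add_tsub_cancel_of_le hve, if_neg (Ne.symm hv)]
      · rfl
    · intro h
      simp [(hu e he).2] at h
  · rw [hf e (not_le.1 he), Finset.sum_eq_zero]
    intro v hv
    have hvN : v.degree = N := by simpa using hv
    rw [if_neg]
    intro hve
    exact he (hvN ▸ Finsupp.degree_mono hve)

/-- Coefficients of the image of a power series under an algebra homomorphism sending monomials
to monomials without lowering degrees. -/
lemma coeff_algHom_of_monomial {σ τ k : Type*} [Finite σ] [CommRing k] [DecidableEq τ]
    (ψ : MvPowerSeries σ k →ₐ[k] MvPowerSeries τ k) (t : (σ →₀ ℕ) → (τ →₀ ℕ))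
    (ht : ∀ e, e.degree ≤ (t e).degree) (hψ : ∀ e, ψ (monomial e 1) = monomial (t e) 1)
    (f : MvPowerSeries σ k) (s : τ →₀ ℕ) :
    coeff s (ψ f) = ∑ e ∈ (Finsupp.finite_of_degree_le (σ := σ) s.degree).toFinset,
      if t e = s then coeff e f else 0 := by
  classical
  set F := (Finsupp.finite_of_degree_le (σ := σ) s.degree).toFinset with hF
  have hmF (e : σ →₀ ℕ) : e ∈ F ↔ e.degree ≤ s.degree := by simp [hF]
  set p : MvPowerSeries σ k := ∑ e ∈ F, coeff e f • monomial e 1 with hp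
  obtain ⟨g, hg⟩ := exists_eq_sum_monomial_mul (s.degree + 1) (f - p) (by
    intro e he
    rw [map_sub, hp, map_sum, Finset.sum_eq_single e]
    · simp
    · intro v _ hv
      simp [coeff_monomial, Ne.symm hv]
    · intro h
      exact absurd ((hmF e).2 (by omega)) h)
  have h0 : coeff s (ψ (f - p)) = 0 := by
    rw [hg, map_sum, map_sum]
    refine Finset.sum_eq_zero fun u hu => ?_
    have hu' : u.degree = s.degree + 1 := by simpa using hu
    rw [map_mul, hψ, coeff_monomial_mul, if_neg]
    intro hle
    have := Finsupp.degree_mono hle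
    have := ht u
    omega
  rw [map_sub, map_sub, sub_eq_zero] at h0
  rw [h0, hp, map_sum, map_sum]
  refine Finset.sum_congr rfl fun e _ => ?_
  rw [map_smul, hψ, coeff_smul, coeff_monomial]
  simp [eq_comm]

/-- The ideal generated by finitely many binomials whose terms have degree `r` is closed: it
contains every power series that agrees in each degree with one of its elements. -/
lemma mem_span_range_binomial {σ k ι : Type*} [CommRing k] [Fintype ι] (r : ℕ)
    (a b : ι → (σ →₀ ℕ)) (ha : ∀ c, (a c).degree = r) (hb : ∀ c, (b c).degree = r)
    (f : MvPowerSeries σ k)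
    (hf : ∀ D, ∃ g ∈ Ideal.span (Set.range fun c => (monomial (a c) (1 : k) - monomial (b c) 1)),
      ∀ e : σ →₀ ℕ, e.degree = D → coeff e f = coeff e g) :
    f ∈ Ideal.span (Set.range fun c => (monomial (a c) (1 : k) - monomial (b c) 1)) := by
  choose g hg hfg using hf
  have hq (D : ℕ) := (Ideal.mem_span_range_iff_exists_fun).1 (hg D)
  choose q hq using hq
  obtain ⟨G, hG⟩ : ∃ G : ι → MvPowerSeries σ k,
      ∀ c d, coeff d (G c) = coeff d (q (d.degree + r) c) :=
    ⟨fun c d => coeff d (q (d.degree + r) c), fun _ _ => rfl⟩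
  refine (Ideal.mem_span_range_iff_exists_fun).2 ⟨G, ?_⟩
  have key (u e : σ →₀ ℕ) (hu : u.degree = r) (c : ι) :
      coeff e (monomial u (1 : k) * G c) = coeff e (monomial u (1 : k) * q e.degree c) := by
    rw [coeff_monomial_mul, coeff_monomial_mul]
    split_ifs with hue
    · rw [hG, ← hu, ← map_add, tsub_add_cancel_of_le hue]
    · rfl
  ext e
  rw [hfg _ e rfl, ← hq e.degree, map_sum, map_sum]
  refine Finset.sum_congr rfl fun c _ => ?_
  rw [mul_comm (G c), mul_comm (q _ _), sub_mul, sub_mul, map_sub, map_sub, key _ _ (ha c),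
    key _ _ (hb c)]

end MvPowerSeries

lemma Finsupp.degree_linearCombination_ge {σ τ : Type*} (v : σ → (τ →₀ ℕ))
    (hv : ∀ i, 1 ≤ (v i).degree) (e : σ →₀ ℕ) :
    e.degree ≤ (Finsupp.linearCombination ℕ v e).degree := by
  induction e using Finsupp.induction_linear with
  | zero => simp
  | add e f he hf => simpa only [map_add] using add_le_add he hf
  | single i c =>
    simpa [Finsupp.linearCombination_single] using Nat.le_mul_of_pos_right c (hv i)

/-- The exponent of the image under `φ` of the variable `x_{ij}`. -/
def detPhiExponent (p : Fin m × Fin n) : Fin m ⊕ Fin (n - 1) →₀ ℕ :=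
  if h : (p.2 : ℕ) < n - 1 then
    Finsupp.single (Sum.inr (⟨p.2, h⟩ : Fin (n - 1))) 1 + Finsupp.single (Sum.inl p.1) 1
  else Finsupp.single (Sum.inl p.1) 1

lemma linearCombination_detPhiExponent_inl (e : Fin m × Fin n →₀ ℕ) (i : Fin m) :
    Finsupp.linearCombination ℕ (detPhiExponent m n) e (Sum.inl i) =
      Finsupp.mapDomain Prod.fst e i := by
  induction e using Finsupp.induction_linear with
  | zero => simp
  | add e f he hf => simp only [map_add, Finsupp.mapDomain_add, Finsupp.add_apply, he, hf]
  | single p c =>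
    rw [Finsupp.linearCombination_single, Finsupp.mapDomain_single, detPhiExponent]
    split_ifs <;> simp [Finsupp.single_apply]

lemma linearCombination_detPhiExponent_inr (e : Fin m × Fin n →₀ ℕ) (j : Fin n)
    (hj : (j : ℕ) < n - 1) :
    Finsupp.linearCombination ℕ (detPhiExponent m n) e (Sum.inr ⟨j, hj⟩) =
      Finsupp.mapDomain Prod.snd e j := by
  induction e using Finsupp.induction_linear with
  | zero => simp
  | add e f he hf => simp only [map_add, Finsupp.mapDomain_add, Finsupp.add_apply, he, hf]
  | single p c =>
    rw [Finsupp.linearCombination_single, Finsupp.mapDomain_single, detPhiExponent]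
    split_ifs with h
    · simp [Finsupp.single_apply, Fin.ext_iff]
    · have : p.2 ≠ j := fun hp => h (hp ▸ hj)
      simp [this]

lemma margins_eq_of_linearCombination_detPhiExponent_eq {e f : Fin m × Fin n →₀ ℕ}
    (h : Finsupp.linearCombination ℕ (detPhiExponent m n) e =
      Finsupp.linearCombination ℕ (detPhiExponent m n) f) :
    Finsupp.mapDomain Prod.fst e = Finsupp.mapDomain Prod.fst f ∧
      Finsupp.mapDomain Prod.snd e = Finsupp.mapDomain Prod.snd f := by
  have hrow : Finsupp.mapDomain Prod.fst e = Finsupp.mapDomain Prod.fst f := by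
    ext i
    rw [← linearCombination_detPhiExponent_inl, h, linearCombination_detPhiExponent_inl]
  have hdeg : (Finsupp.mapDomain Prod.snd e).degree = (Finsupp.mapDomain Prod.snd f).degree := by
    rw [Finsupp.degree_mapDomain, Finsupp.degree_mapDomain,
      ← Finsupp.degree_mapDomain Prod.fst e, hrow, Finsupp.degree_mapDomain]
  have hcol (j : Fin n) (hj : (j : ℕ) < n - 1) :
      Finsupp.mapDomain Prod.snd e j = Finsupp.mapDomain Prod.snd f j := by
    rw [← linearCombination_detPhiExponent_inr m n e j hj, h,
      linearCombination_detPhiExponent_inr]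
  refine ⟨hrow, ?_⟩
  ext j
  by_cases hj : (j : ℕ) < n - 1
  · exact hcol j hj
  · rw [Finsupp.degree_eq_sum, Finsupp.degree_eq_sum,
      ← Finset.add_sum_erase _ _ (Finset.mem_univ j),
      ← Finset.add_sum_erase _ _ (Finset.mem_univ j),
      Finset.sum_congr rfl fun l hl => hcol l (by
        have := Finset.ne_of_mem_erase hl
        have := Fin.val_ne_of_ne this
        omega)] at hdeg
    exact Nat.add_right_cancel hdeg

lemma Finsupp.exists_apply_ne_zero_of_mapDomain_ne_zero {α β : Type*} (g : α → β) (e : α →₀ ℕ)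
    {b : β} (h : Finsupp.mapDomain g e b ≠ 0) : ∃ a, g a = b ∧ e a ≠ 0 := by
  classical
  obtain ⟨a, ha, hab⟩ := Finset.mem_image.1
    (Finsupp.mapDomain_support (Finsupp.mem_support_iff.2 h))
  exact ⟨a, hab, Finsupp.mem_support_iff.1 ha⟩

lemma minor_mem_detI2 (i k : Fin m) (j l : Fin n) :
    (X (i, j) * X (k, l) - X (i, l) * X (k, j) : DetP 𝕜 m n) ∈ detI2 𝕜 m n := by
  rcases lt_trichotomy i k with hik | rfl | hik
  · rcases lt_trichotomy j l with hjl | rfl | hjl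
    · exact Ideal.subset_span ⟨i, k, j, l, hik, hjl, rfl⟩
    · simp
    · rw [← neg_sub]
      exact neg_mem (Ideal.subset_span ⟨i, k, l, j, hik, hjl, rfl⟩)
  · rw [mul_comm, sub_self]
    exact zero_mem _
  · rcases lt_trichotomy j l with hjl | rfl | hjl
    · have : (X (i, j) * X (k, l) - X (i, l) * X (k, j) : DetP 𝕜 m n) =
          -(X (k, j) * X (i, l) - X (k, l) * X (i, j)) := by ring
      rw [this]
      exact neg_mem (Ideal.subset_span ⟨k, i, j, l, hik, hjl, rfl⟩)
    · simp
    · have : (X (i, j) * X (k, l) - X (i, l) * X (k, j) : DetP 𝕜 m n) =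
          X (k, l) * X (i, j) - X (k, j) * X (i, l) := by ring
      rw [this]
      exact Ideal.subset_span ⟨k, i, l, j, hik, hjl, rfl⟩

/-- The ideal of `2 × 2` minors as the span of a finite family of binomials. -/
lemma detI2_eq_span_range :
    detI2 𝕜 m n = Ideal.span (Set.range fun c : (Fin m × Fin m) × (Fin n × Fin n) =>
      (monomial (Finsupp.single (c.1.1, c.2.1) 1 + Finsupp.single (c.1.2, c.2.2) 1) (1 : 𝕜) -
        monomial (Finsupp.single (c.1.1, c.2.2) 1 + Finsupp.single (c.1.2, c.2.1) 1) 1)) := by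
  have hminor (i k : Fin m) (j l : Fin n) :
      (monomial (Finsupp.single (i, j) 1 + Finsupp.single (k, l) 1) (1 : 𝕜) -
        monomial (Finsupp.single (i, l) 1 + Finsupp.single (k, j) 1) 1) =
      X (i, j) * X (k, l) - X (i, l) * X (k, j) := by
    simp only [X, monomial_mul_monomial, one_mul]
  apply le_antisymm
  · refine Ideal.span_le.2 ?_
    rintro _ ⟨i, k, j, l, -, -, rfl⟩
    exact Ideal.subset_span ⟨((i, k), (j, l)), hminor i k j l⟩
  · refine Ideal.span_le.2 ?_
    rintro _ ⟨⟨⟨i, k⟩, ⟨j, l⟩⟩, rfl⟩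
    change _ - _ ∈ detI2 𝕜 m n
    rw [hminor]
    exact minor_mem_detI2 𝕜 m n i k j l

/-- Modulo the `2 × 2` minors, a variable can be split off a monomial as soon as its row and its
column both occur. -/
lemma exists_mk_monomial_eq (f : Fin m × Fin n →₀ ℕ) (i : Fin m) (j : Fin n)
    (hi : Finsupp.mapDomain Prod.fst f i ≠ 0) (hj : Finsupp.mapDomain Prod.snd f j ≠ 0) :
    ∃ w : Fin m × Fin n →₀ ℕ,
      Ideal.Quotient.mk (detI2 𝕜 m n) (monomial f 1) =
        Ideal.Quotient.mk (detI2 𝕜 m n) (monomial (Finsupp.single (i, j) 1 + w) 1) ∧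
      Finsupp.mapDomain Prod.fst f = Finsupp.mapDomain Prod.fst (Finsupp.single (i, j) 1 + w) ∧
      Finsupp.mapDomain Prod.snd f = Finsupp.mapDomain Prod.snd (Finsupp.single (i, j) 1 + w) := by
  by_cases hij : f (i, j) = 0
  · obtain ⟨⟨i', l⟩, hi' : i' = i, hil⟩ :=
      Finsupp.exists_apply_ne_zero_of_mapDomain_ne_zero _ _ hi
    obtain ⟨⟨k, j'⟩, hj' : j' = j, hkj⟩ :=
      Finsupp.exists_apply_ne_zero_of_mapDomain_ne_zero _ _ hj
    subst hi' hj'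
    have hle : Finsupp.single (i', l) 1 + Finsupp.single (k, j') 1 ≤ f := by
      intro p
      rw [Finsupp.add_apply, Finsupp.single_apply, Finsupp.single_apply]
      split_ifs with h1 h2 h2
      · obtain ⟨rfl, rfl⟩ := Prod.mk.inj (h1.trans h2.symm)
        exact absurd hij hil
      · subst h1; omega
      · subst h2; omega
      · omega
    obtain ⟨w, rfl⟩ := exists_add_of_le hle
    refine ⟨Finsupp.single (k, l) 1 + w, ?_, ?_, ?_⟩
    · rw [eq_comm, Ideal.Quotient.eq]
      have : (monomial (Finsupp.single (i', j') 1 + (Finsupp.single (k, l) 1 + w)) (1 : 𝕜) -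
          monomial (Finsupp.single (i', l) 1 + Finsupp.single (k, j') 1 + w) 1) =
          (X (i', j') * X (k, l) - X (i', l) * X (k, j')) * monomial w 1 := by
        simp only [X, monomial_mul_monomial, one_mul, sub_mul, add_assoc]
      rw [this]
      exact Ideal.mul_mem_right _ _ (minor_mem_detI2 𝕜 m n i' k j' l)
    · simp only [Finsupp.mapDomain_add, Finsupp.mapDomain_single]
      abel
    · simp only [Finsupp.mapDomain_add, Finsupp.mapDomain_single]
      abel
  · have hle : Finsupp.single (i, j) 1 ≤ f := by
      rw [Finsupp.single_le_iff]
      omega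
    obtain ⟨w, rfl⟩ := exists_add_of_le hle
    exact ⟨w, rfl, rfl, rfl⟩

/-- Monomials with the same row and column sums agree modulo the `2 × 2` minors. -/
lemma mk_monomial_eq_of_margins_eq (e f : Fin m × Fin n →₀ ℕ)
    (h₁ : Finsupp.mapDomain Prod.fst e = Finsupp.mapDomain Prod.fst f)
    (h₂ : Finsupp.mapDomain Prod.snd e = Finsupp.mapDomain Prod.snd f) :
    Ideal.Quotient.mk (detI2 𝕜 m n) (monomial e 1) =
      Ideal.Quotient.mk (detI2 𝕜 m n) (monomial f 1) := by
  induction hd : e.degree generalizing e f with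
  | zero =>
    have hf : f.degree = 0 := by
      rw [← Finsupp.degree_mapDomain Prod.fst f, ← h₁, Finsupp.degree_mapDomain, hd]
    rw [(Finsupp.degree_eq_zero_iff e).1 hd, (Finsupp.degree_eq_zero_iff f).1 hf]
  | succ d ih =>
    obtain ⟨⟨i, j⟩, hij⟩ : ∃ p, e p ≠ 0 := by
      by_contra! h
      rw [(Finsupp.ext h : e = 0)] at hd
      simp at hd
    obtain ⟨v, rfl⟩ := exists_add_of_le
      (Finsupp.single_le_iff.2 (Nat.one_le_iff_ne_zero.2 hij))
    obtain ⟨w, hw, hw₁, hw₂⟩ := exists_mk_monomial_eq 𝕜 m n f i j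
      (by rw [← h₁]; simp [Finsupp.mapDomain_add])
      (by rw [← h₂]; simp [Finsupp.mapDomain_add])
    rw [hw₁, Finsupp.mapDomain_add, Finsupp.mapDomain_add, add_right_inj] at h₁
    rw [hw₂, Finsupp.mapDomain_add, Finsupp.mapDomain_add, add_right_inj] at h₂
    have hv : v.degree = d := by
      rw [map_add, Finsupp.degree_single] at hd
      omega
    have hsplit (u : Fin m × Fin n →₀ ℕ) :
        (monomial (Finsupp.single (i, j) 1 + u) (1 : 𝕜)) = X (i, j) * monomial u 1 := by
      simp only [X, monomial_mul_monomial, one_mul]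
    rw [hw, hsplit, hsplit, map_mul, map_mul, ih v w h₁ h₂ hv]

lemma IsDetPhi.map_monomial {φ : DetR 𝕜 m n →ₐ[𝕜] DetS 𝕜 m n} (hφ : IsDetPhi 𝕜 m n φ)
    (e : Fin m × Fin n →₀ ℕ) :
    φ (Ideal.Quotient.mk (detI2 𝕜 m n) (monomial e 1)) =
      monomial (Finsupp.linearCombination ℕ (detPhiExponent m n) e) 1 := by
  induction e using Finsupp.induction_linear with
  | zero => simp
  | add e f he hf =>
    rw [map_add, ← one_mul (1 : 𝕜), ← monomial_mul_monomial, ← monomial_mul_monomial,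
      map_mul, map_mul, he, hf]
  | single p c =>
    have hX : φ (Ideal.Quotient.mk (detI2 𝕜 m n) (X p)) = monomial (detPhiExponent m n p) 1 := by
      refine (hφ p.1 p.2).trans ?_
      rw [detPhiExponent]
      split_ifs
      · simp only [X, monomial_mul_monomial, one_mul]
      · rfl
    rw [← X_pow_eq, map_pow, map_pow, hX, monomial_pow, one_pow,
      Finsupp.linearCombination_single]

/-- The graded pieces of a power series killed by `φ` lie in the ideal of minors. -/
lemma IsDetPhi.sum_monomial_mem {φ : DetR 𝕜 m n →ₐ[𝕜] DetS 𝕜 m n} (hφ : IsDetPhi 𝕜 m n φ)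
    (f : DetP 𝕜 m n) (hf : φ (Ideal.Quotient.mk (detI2 𝕜 m n) f) = 0) (D : ℕ) :
    ∑ e ∈ (Finsupp.finite_of_degree_eq (σ := Fin m × Fin n) D).toFinset,
      coeff e f • monomial e (1 : 𝕜) ∈ detI2 𝕜 m n := by
  classical
  set t := Finsupp.linearCombination ℕ (detPhiExponent m n) with ht
  have htdeg (e : Fin m × Fin n →₀ ℕ) : e.degree ≤ (t e).degree := by
    refine Finsupp.degree_linearCombination_ge _ (fun p => ?_) e
    rw [detPhiExponent]
    split_ifs <;> simp
  have hcoeff (s : Fin m ⊕ Fin (n - 1) →₀ ℕ) :=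
    coeff_algHom_of_monomial (φ.comp (Ideal.Quotient.mkₐ 𝕜 (detI2 𝕜 m n))) t htdeg
      (hφ.map_monomial 𝕜 m n) f s
  simp only [AlgHom.comp_apply, Ideal.Quotient.mkₐ_eq_mk, hf, map_zero] at hcoeff
  set F := (Finsupp.finite_of_degree_eq (σ := Fin m × Fin n) D).toFinset with hF
  have hmF (e : Fin m × Fin n →₀ ℕ) : e ∈ F ↔ e.degree = D := by simp [hF]
  rw [← Ideal.Quotient.eq_zero_iff_mem, map_sum,
    ← Finset.sum_fiberwise_of_maps_to (g := t) (t := F.image t)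
      fun e he => Finset.mem_image_of_mem t he]
  refine Finset.sum_eq_zero fun s hs => ?_
  obtain ⟨e₀, he₀, rfl⟩ := Finset.mem_image.1 hs
  have hfib : ∀ e ∈ F.filter (fun e => t e = t e₀),
      Ideal.Quotient.mk (detI2 𝕜 m n) (coeff e f • monomial e (1 : 𝕜)) =
        coeff e f • Ideal.Quotient.mk (detI2 𝕜 m n) (monomial e₀ 1) := by
    intro e he
    obtain ⟨h₁, h₂⟩ := margins_eq_of_linearCombination_detPhiExponent_eq m n
      (Finset.mem_filter.1 he).2
    rw [← mk_monomial_eq_of_margins_eq 𝕜 m n e e₀ h₁ h₂]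
    rfl
  rw [Finset.sum_congr rfl hfib, ← Finset.sum_smul]
  have hzero : ∑ e ∈ F.filter (fun e => t e = t e₀), coeff e f = 0 := by
    rw [hcoeff (t e₀), ← Finset.sum_filter]
    refine Finset.sum_congr ?_ fun _ _ => rfl
    ext e
    simp only [Finset.mem_filter, hmF, Set.Finite.mem_toFinset, Set.mem_ofPred_eq]
    refine and_congr_left fun he => ⟨fun _ => he ▸ htdeg e, fun _ => ?_⟩
    rw [← (hmF e₀).1 he₀, ← Finsupp.degree_mapDomain Prod.fst e,
      (margins_eq_of_linearCombination_detPhiExponent_eq m n he).1, Finsupp.degree_mapDomain]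
  rw [hzero, zero_smul]

/-- the homomorphism `φ : R → S` is injective. -/
theorem statement1 (hm : 2 ≤ m) (hn : 2 ≤ n)
    (φ : DetR 𝕜 m n →ₐ[𝕜] DetS 𝕜 m n) (hφ : IsDetPhi 𝕜 m n φ) :
    Function.Injective φ := by
  classical
  rw [injective_iff_map_eq_zero]
  intro x hx
  obtain ⟨f, rfl⟩ := Ideal.Quotient.mk_surjective x
  rw [Ideal.Quotient.eq_zero_iff_mem, detI2_eq_span_range]
  refine mem_span_range_binomial 2 _ _ (by simp) (by simp) f fun D =>
    ⟨_, detI2_eq_span_range 𝕜 m n ▸ hφ.sum_monomial_mem 𝕜 m n f hx D, fun e he => ?_⟩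
  rw [map_sum, Finset.sum_eq_single e]
  · simp
  · intro v _ hv
    simp [coeff_monomial, Ne.symm hv]
  · intro h
    simp [he] at h
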